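/- arXiv:2305.15086 — 2 statements merged into one kernel-verified Lean document; each statement's English description precedes it below -/
import Mathlib

section
/- For any probability measures P and Q on a measurable space X, the Kullback–Leibler divergence satisfies the Donsker–Varadhan variational formula: D_KL(P ‖ Q) = sup over all bounded measurable functions T : X → ℝ of ( ∫ T dP − log ∫ e^T dQ ). -/
open MeasureTheory ProbabilityTheory
open scoped Classical

noncomputable section

/-- KL divergence with values in `EReal` (⊤ if not absolutely continuous or not integrable). -/
noncomputable def klDiv {α : Type*} [MeasurableSpace α] (μ ν : Measure α) : EReal :=
  if μ ≪ ν ∧ Integrable (llr μ ν) μ then ((∫ x, llr μ ν x ∂μ : ℝ) : EReal) else ⊤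

section DonskerVaradhan

open Filter Topology

variable {X : Type*} [MeasurableSpace X] {P Q : Measure X}

lemma integrable_of_measurable_of_abs_le [IsFiniteMeasure P] {f : X → ℝ} (hf : Measurable f)
    {C : ℝ} (hC : ∀ x, |f x| ≤ C) : Integrable f P :=
  .of_bound hf.aestronglyMeasurable C (ae_of_all _ hC)

lemma integrable_exp_of_measurable_of_abs_le [IsFiniteMeasure P] {f : X → ℝ} (hf : Measurable f)
    {C : ℝ} (hC : ∀ x, |f x| ≤ C) : Integrable (fun x ↦ Real.exp (f x)) P :=
  integrable_of_measurable_of_abs_le (C := Real.exp C) hf.exp fun x ↦ by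
    rw [Real.abs_exp]
    exact Real.exp_le_exp.2 ((le_abs_self _).trans (hC x))

variable [IsProbabilityMeasure P] [IsProbabilityMeasure Q]

/-- The Donsker–Varadhan functional is at most the relative entropy, by Gibbs' inequality for the
exponentially tilted measure. -/
lemma integral_sub_log_integral_exp_le (hPQ : P ≪ Q) (hint : Integrable (llr P Q) P)
    {T : X → ℝ} (hTP : Integrable T P) (hTQ : Integrable (fun x ↦ Real.exp (T x)) Q) :
    ∫ x, T x ∂P - Real.log (∫ x, Real.exp (T x) ∂Q) ≤ ∫ x, llr P Q x ∂P := by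
  have := isProbabilityMeasure_tilted hTQ
  have hgibbs := InformationTheory.integral_llr_add_sub_measure_univ_nonneg
    (hPQ.trans (absolutelyContinuous_tilted hTQ)) (integrable_llr_tilted_right hPQ hTP hint hTQ)
  rw [integral_llr_tilted_right hPQ hTP hTQ hint] at hgibbs
  simp only [probReal_univ] at hgibbs
  linarith

/-- If `e ^ T ≤ a + dP/dQ`, then the Donsker–Varadhan functional at `T` is at least `∫ T dP - a`. -/
lemma integral_sub_le_of_exp_le {T : X → ℝ} {a : ℝ}
    (hTQ : Integrable (fun x ↦ Real.exp (T x)) Q)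
    (hle : ∀ x, Real.exp (T x) ≤ a + (P.rnDeriv Q x).toReal) :
    ∫ x, T x ∂P - a ≤ ∫ x, T x ∂P - Real.log (∫ x, Real.exp (T x) ∂Q) := by
  have hint : ∫ x, Real.exp (T x) ∂Q ≤ a + 1 := by
    calc ∫ x, Real.exp (T x) ∂Q ≤ ∫ x, (a + (P.rnDeriv Q x).toReal) ∂Q :=
          integral_mono hTQ ((integrable_const _).add Measure.integrable_toReal_rnDeriv) hle
      _ = a + ∫ x, (P.rnDeriv Q x).toReal ∂Q := by
          rw [integral_add (integrable_const _) Measure.integrable_toReal_rnDeriv]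
          simp
      _ ≤ a + 1 := by
          gcongr
          simpa using Measure.setIntegral_toReal_rnDeriv_le (μ := P) (ν := Q) (s := Set.univ)
            (measure_ne_top _ _)
  have := Real.log_le_sub_one_of_pos (integral_exp_pos hTQ)
  linarith

lemma absolutelyContinuous_of_forall_le {c : ℝ}
    (hc : ∀ T : X → ℝ, Measurable T → (∃ C : ℝ, ∀ x, |T x| ≤ C) →
      ∫ x, T x ∂P - Real.log (∫ x, Real.exp (T x) ∂Q) ≤ c) : P ≪ Q := by
  refine Measure.AbsolutelyContinuous.mk fun s hs hQs ↦ ?_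
  by_contra hPs
  have hpos : 0 < P.real s := ENNReal.toReal_pos hPs (measure_ne_top _ _)
  obtain ⟨n, hn⟩ := exists_nat_gt (c / P.real s)
  have h := hc (s.indicator fun _ ↦ (n : ℝ)) (measurable_const.indicator hs)
    ⟨n, fun x ↦ by by_cases hx : x ∈ s <;> simp [hx]⟩
  have hexp : (fun x ↦ Real.exp (s.indicator (fun _ ↦ (n : ℝ)) x)) =ᵐ[Q] fun _ ↦ 1 := by
    filter_upwards [measure_eq_zero_iff_ae_notMem.1 hQs] with x hx
    simp [hx]
  rw [integral_congr_ae hexp, integral_indicator_const _ hs] at h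
  rw [div_lt_iff₀ hpos] at hn
  simp at h
  linarith

lemma integrable_llr_of_forall_le {c : ℝ}
    (hc : ∀ T : X → ℝ, Measurable T → (∃ C : ℝ, ∀ x, |T x| ≤ C) →
      ∫ x, T x ∂P - Real.log (∫ x, Real.exp (T x) ∂Q) ≤ c)
    (hPQ : P ≪ Q) : Integrable (llr P Q) P := by
  have hmeas : Measurable (llr P Q) := measurable_llr P Q
  let U : ℕ → X → ℝ := fun n x ↦ min n (max (llr P Q x) 0)
  have hU_meas (n : ℕ) : Measurable (U n) := measurable_const.min (hmeas.max measurable_const)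
  have hU_nonneg (n : ℕ) (x : X) : 0 ≤ U n x := le_min n.cast_nonneg (le_max_right _ _)
  have hU_abs (n : ℕ) (x : X) : |U n x| ≤ n := by
    rw [abs_of_nonneg (hU_nonneg n x)]
    exact min_le_left _ _
  have hU_exp (n : ℕ) (x : X) : Real.exp (U n x) ≤ 1 + (P.rnDeriv Q x).toReal := by
    have hr : 0 ≤ (P.rnDeriv Q x).toReal := ENNReal.toReal_nonneg
    refine (Real.exp_le_exp.2 (min_le_right _ _)).trans ?_
    rcases le_total (llr P Q x) 0 with h | h
    · simp [h]
    · rw [max_eq_left h, llr_def]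
      rcases hr.eq_or_lt with h0 | h0
      · simp [← h0]
      · simp [Real.exp_log h0]
  have hU_int (n : ℕ) : ∫ x, U n x ∂P ≤ c + 1 := by
    have h1 := integral_sub_le_of_exp_le (P := P)
      (integrable_exp_of_measurable_of_abs_le (P := Q) (hU_meas n) (hU_abs n)) (hU_exp n)
    linarith [hc (U n) (hU_meas n) ⟨n, hU_abs n⟩]
  have hlim := lintegral_tendsto_of_tendsto_of_monotone (μ := P)
    (f := fun n x ↦ ENNReal.ofReal (U n x)) (F := fun x ↦ ENNReal.ofReal (max (llr P Q x) 0))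
    (fun n ↦ (hU_meas n).ennreal_ofReal.aemeasurable)
    (ae_of_all _ fun x m n hmn ↦ ENNReal.ofReal_le_ofReal
      (min_le_min_right _ (Nat.cast_le.2 hmn)))
    (ae_of_all _ fun x ↦ by
      obtain ⟨N, hN⟩ := exists_nat_ge (max (llr P Q x) 0)
      refine tendsto_const_nhds.congr' ?_
      filter_upwards [eventually_ge_atTop N] with n hn
      simp only [U, min_eq_right (hN.trans (Nat.cast_le.2 hn))])
  have hpos : Integrable (fun x ↦ max (llr P Q x) 0) P := by
    refine (lintegral_ofReal_ne_top_iff_integrable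
      (hmeas.max measurable_const).aestronglyMeasurable
      (ae_of_all _ fun _ ↦ le_max_right _ _)).1 (ne_top_of_le_ne_top ENNReal.ofReal_ne_top
        (le_of_tendsto' (b := ENNReal.ofReal (c + 1)) hlim fun n ↦ ?_))
    rw [← ofReal_integral_eq_lintegral_ofReal
      (integrable_of_measurable_of_abs_le (hU_meas n) (hU_abs n)) (ae_of_all _ (hU_nonneg n))]
    exact ENNReal.ofReal_le_ofReal (hU_int n)
  have hneg : Integrable (fun x ↦ Real.exp (-llr P Q x)) P :=
    (integrable_congr (exp_neg_llr hPQ)).2 Measure.integrable_toReal_rnDeriv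
  refine (hpos.add hneg).mono' hmeas.aestronglyMeasurable (ae_of_all _ fun x ↦ ?_)
  have hexp := Real.add_one_le_exp (-llr P Q x)
  have hexp_pos := Real.exp_pos (-llr P Q x)
  have hmax := le_max_left (llr P Q x) 0
  have hmax' := le_max_right (llr P Q x) 0
  simp only [Pi.add_apply]
  exact abs_le.2 ⟨by linarith, by linarith⟩

lemma integral_llr_le_of_forall_le {c : ℝ}
    (hc : ∀ T : X → ℝ, Measurable T → (∃ C : ℝ, ∀ x, |T x| ≤ C) →
      ∫ x, T x ∂P - Real.log (∫ x, Real.exp (T x) ∂Q) ≤ c)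
    (hPQ : P ≪ Q) (hint : Integrable (llr P Q) P) :
    ∫ x, llr P Q x ∂P ≤ c := by
  have hmeas : Measurable (llr P Q) := measurable_llr P Q
  -- The value on `{dP/dQ = 0}` is set by hand, since there `llr P Q` is `Real.log 0 = 0`.
  let V : ℕ → X → ℝ := fun n x ↦
    if (P.rnDeriv Q x).toReal = 0 then -n else max (-n) (min n (llr P Q x))
  have hV_meas (n : ℕ) : Measurable (V n) :=
    Measurable.ite ((Measure.measurable_rnDeriv P Q).ennreal_toReal (measurableSet_singleton 0))
      measurable_const (measurable_const.max (measurable_const.min hmeas))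
  have hV_abs (n : ℕ) (x : X) : |V n x| ≤ n := by
    have hn : (0 : ℝ) ≤ n := n.cast_nonneg
    simp only [V]
    split_ifs
    · simp
    · exact abs_le.2 ⟨le_max_left _ _, max_le (by linarith) (min_le_left _ _)⟩
  have hV_exp (n : ℕ) (x : X) :
      Real.exp (V n x) ≤ Real.exp (-n) + (P.rnDeriv Q x).toReal := by
    have hr : 0 ≤ (P.rnDeriv Q x).toReal := ENNReal.toReal_nonneg
    simp only [V]
    split_ifs with h0
    · simp [h0]
    · have hr' : Real.exp (llr P Q x) = (P.rnDeriv Q x).toReal :=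
        Real.exp_log (hr.lt_of_ne' h0)
      rw [Real.exp_monotone.map_max]
      refine max_le (by linarith) ?_
      have := Real.exp_le_exp.2 (min_le_right (n : ℝ) (llr P Q x))
      linarith [Real.exp_pos (-(n : ℝ))]
  have hr_pos : ∀ᵐ x ∂P, (P.rnDeriv Q x).toReal ≠ 0 := by
    filter_upwards [Measure.rnDeriv_pos hPQ, hPQ.ae_le (Measure.rnDeriv_lt_top P Q)] with x h1 h2
    exact (ENNReal.toReal_pos h1.ne' h2.ne).ne'
  have hV_lim : Tendsto (fun n ↦ ∫ x, V n x ∂P) atTop (𝓝 (∫ x, llr P Q x ∂P)) := by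
    refine tendsto_integral_of_dominated_convergence (fun x ↦ |llr P Q x|)
      (fun n ↦ (hV_meas n).aestronglyMeasurable) hint.abs (fun n ↦ ?_) ?_
    · filter_upwards [hr_pos] with x hx
      have hn : (0 : ℝ) ≤ n := n.cast_nonneg
      simp only [V, if_neg hx, Real.norm_eq_abs]
      refine abs_le.2 ⟨le_max_of_le_right (le_min ?_ (neg_abs_le _)),
        max_le ?_ ((min_le_right _ _).trans (le_abs_self _))⟩ <;>
      linarith [abs_nonneg (llr P Q x)]
    · filter_upwards [hr_pos] with x hx
      obtain ⟨N, hN⟩ := exists_nat_ge |llr P Q x|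
      refine tendsto_const_nhds.congr' ?_
      filter_upwards [eventually_ge_atTop N] with n hn
      have hle := abs_le.1 (hN.trans (Nat.cast_le.2 hn))
      simp only [V, if_neg hx]
      rw [min_eq_right hle.2, max_eq_right hle.1]
  have hexp_lim : Tendsto (fun n : ℕ ↦ Real.exp (-n)) atTop (𝓝 0) :=
    Real.tendsto_exp_neg_atTop_nhds_zero.comp tendsto_natCast_atTop_atTop
  have hlim := hV_lim.sub hexp_lim
  rw [sub_zero] at hlim
  exact le_of_tendsto' hlim fun n ↦ (integral_sub_le_of_exp_le
    (integrable_exp_of_measurable_of_abs_le (hV_meas n) (hV_abs n)) (hV_exp n)).trans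
      (hc (V n) (hV_meas n) ⟨n, hV_abs n⟩)

lemma klDiv_le_of_forall_le {c : ℝ}
    (hc : ∀ T : X → ℝ, Measurable T → (∃ C : ℝ, ∀ x, |T x| ≤ C) →
      ∫ x, T x ∂P - Real.log (∫ x, Real.exp (T x) ∂Q) ≤ c) : klDiv P Q ≤ c := by
  have hPQ := absolutelyContinuous_of_forall_le hc
  have hint := integrable_llr_of_forall_le hc hPQ
  rw [klDiv, if_pos ⟨hPQ, hint⟩]
  exact EReal.coe_le_coe_iff.2 (integral_llr_le_of_forall_le hc hPQ hint)

end DonskerVaradhan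

/-- Donsker–Varadhan variational formula: for probability measures `P`, `Q`,
`D_KL(P ‖ Q) = sup { ∫ T dP - log ∫ e^T dQ : T bounded measurable }`. -/
theorem stmt_8 {X : Type*} [MeasurableSpace X] (P Q : Measure X)
    [IsProbabilityMeasure P] [IsProbabilityMeasure Q] :
    klDiv P Q = ⨆ (T : X → ℝ) (_ : Measurable T) (_ : ∃ C : ℝ, ∀ x, |T x| ≤ C),
      (((∫ x, T x ∂P) - Real.log (∫ x, Real.exp (T x) ∂Q) : ℝ) : EReal) := by
  refine le_antisymm ?_ (iSup_le fun T ↦ iSup_le fun hT ↦ iSup_le fun ⟨C, hC⟩ ↦ ?_)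
  · refine EReal.le_of_forall_lt_iff_le.1 fun c hc ↦
      klDiv_le_of_forall_le fun T hT hC ↦ EReal.coe_le_coe_iff.1 (le_trans ?_ hc.le)
    exact le_iSup_of_le T (le_iSup_of_le hT (le_iSup_of_le hC le_rfl))
  · rw [klDiv]
    split_ifs with h
    · exact EReal.coe_le_coe_iff.2 (integral_sub_log_integral_exp_le h.1 h.2
        (integrable_of_measurable_of_abs_le hT hC) (integrable_exp_of_measurable_of_abs_le hT hC))
    · exact le_top

end
end

section
/- Let d ≥ 2 and 0 < r_1 < r_2, and let σ_1 and σ_2 be the uniform (normalized surface) probability measures on the spheres S(0, r_1) and S(0, r_2) in ℝ^d. Then: (a) the pushforward of σ_1 under the scaling map x ↦ (r_2/r_1) x equals σ_2; (b) every coupling γ ∈ Π(σ_1, σ_2) satisfies ∫ ‖x − y‖² dγ(x, y) ≥ (r_2 − r_1)²; (c) the coupling γ* defined as the pushforward of σ_1 under x ↦ (x, (r_2/r_1) x) belongs to Π(σ_1, σ_2) and achieves ∫ ‖x − y‖² dγ* = (r_2 − r_1)², and it is the unique minimizer; in particular, γ*-almost every pair (x, y) satisfies ⟨x, y⟩/(‖x‖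 ‖y‖) = 1, i.e., the optimal quadratic-cost transport between the two concentric spheres moves points radially outwards. -/
open MeasureTheory ProbabilityTheory
open scoped RealInnerProductSpace

noncomputable section

/-- Euclidean space ℝ^d. -/
abbrev E (d : ℕ) : Type := EuclideanSpace ℝ (Fin d)

/-- `γ` is a coupling of `μ` and `ν` (an element of `Π(μ, ν)`). -/
def IsCoupling {α : Type*} [MeasurableSpace α] (μ ν : Measure α) (γ : Measure (α × α)) : Prop :=
  IsProbabilityMeasure γ ∧ γ.map Prod.fst = μ ∧ γ.map Prod.snd = ν

/-- The uniform probability measure on the sphere `S(0, r)` in ℝ^d: the normalized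
`(d-1)`-dimensional Hausdorff (surface) measure on the sphere. -/
noncomputable def uniformSphere (d : ℕ) (r : ℝ) : Measure (E d) :=
  (μH[(d : ℝ) - 1] (Metric.sphere (0 : E d) r))⁻¹ •
    (μH[(d : ℝ) - 1] : Measure (E d)).restrict (Metric.sphere (0 : E d) r)

/-- The central projection of the hyperplane `x i = s` to the sphere of radius `r`. -/
def faceToSphere (n : ℕ) (r : ℝ) (i : Fin (n + 1)) (s : ℝ) (y : Fin n → ℝ) : E (n + 1) :=
  (r * ‖(WithLp.toLp 2 (i.insertNth s y : Fin (n + 1) → ℝ) : E (n + 1))‖⁻¹) •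
    (WithLp.toLp 2 (i.insertNth s y : Fin (n + 1) → ℝ) : E (n + 1))

lemma contDiff_faceToSphere (n : ℕ) (r : ℝ) (i : Fin (n + 1)) {s : ℝ} (hs : s ≠ 0) :
    ContDiff ℝ 1 (faceToSphere n r i s) := by
  have hz : ContDiff ℝ 1 (fun y : Fin n → ℝ =>
      (WithLp.toLp 2 (i.insertNth s y : Fin (n + 1) → ℝ) : E (n + 1))) := by
    rw [contDiff_euclidean]
    intro j
    induction j using Fin.succAboveCases i with
    | x => simpa using contDiff_const
    | p j => simpa using contDiff_apply ℝ ℝ j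
  have hne (y : Fin n → ℝ) :
      (WithLp.toLp 2 (i.insertNth s y : Fin (n + 1) → ℝ) : E (n + 1)) ≠ 0 := by
    intro h
    apply hs
    simpa using congrArg (fun v : E (n + 1) => v i) h
  exact (contDiff_const.mul ((hz.norm ℝ hne).inv fun y => norm_ne_zero_iff.2 (hne y))).smul hz

lemma sphere_subset_iUnion_faceToSphere (n : ℕ) {r : ℝ} (hr : 0 < r) :
    Metric.sphere (0 : E (n + 1)) r ⊆ ⋃ i : Fin (n + 1),
      (faceToSphere n r i 1 '' Metric.closedBall 0 1 ∪
        faceToSphere n r i (-1) '' Metric.closedBall 0 1) := by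
  intro x hx
  have hxr : ‖x‖ = r := by simpa using hx
  obtain ⟨i, hi⟩ := Finite.exists_max (fun i => |x i|)
  have hm : 0 < |x i| := by
    by_contra! h
    have hx0 : x = 0 := by
      ext j
      simpa using abs_nonpos_iff.1 ((hi j).trans h)
    simp [hx0] at hxr
    linarith
  have hy : (fun j => |x i|⁻¹ * x (i.succAbove j)) ∈ Metric.closedBall (0 : Fin n → ℝ) 1 := by
    rw [mem_closedBall_zero_iff, pi_norm_le_iff_of_nonneg zero_le_one]
    intro j
    rw [Real.norm_eq_abs, abs_mul, abs_inv, abs_abs, inv_mul_le_one₀ hm]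
    exact hi _
  have hface : faceToSphere n r i (|x i|⁻¹ * x i) (fun j => |x i|⁻¹ * x (i.succAbove j)) = x := by
    have hz : (WithLp.toLp 2 (i.insertNth (|x i|⁻¹ * x i)
        (fun j => |x i|⁻¹ * x (i.succAbove j)) : Fin (n + 1) → ℝ) : E (n + 1)) =
          |x i|⁻¹ • x := by
      ext j
      induction j using Fin.succAboveCases i with
      | x => simp
      | p j => simp
    rw [faceToSphere, hz, norm_smul, hxr, smul_smul, norm_inv, Real.norm_eq_abs, abs_abs]
    convert one_smul ℝ x using 2
    field_simp
  refine Set.mem_iUnion.2 ⟨i, ?_⟩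
  rcases abs_cases (x i) with ⟨h, -⟩ | ⟨h, -⟩
  · have hs : |x i|⁻¹ * x i = 1 := (inv_mul_eq_one₀ hm.ne').2 h
    exact .inl ⟨_, hy, hs ▸ hface⟩
  · have hs : |x i|⁻¹ * x i = -1 := by
      rw [inv_mul_eq_iff_eq_mul₀ hm.ne']
      linarith
    exact .inr ⟨_, hy, hs ▸ hface⟩

lemma hausdorffMeasure_eq_volume_pi (n : ℕ) : (μH[(n : ℝ)] : Measure (Fin n → ℝ)) = volume := by
  simpa using hausdorffMeasure_pi_real (ι := Fin n)

lemma hausdorffMeasure_sphere_lt_top (n : ℕ) {r : ℝ} (hr : 0 < r) :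
    μH[(n : ℝ)] (Metric.sphere (0 : E (n + 1)) r) < ⊤ := by
  have hface (i : Fin (n + 1)) {s : ℝ} (hs : s ≠ 0) :
      μH[(n : ℝ)] (faceToSphere n r i s '' Metric.closedBall 0 1) < ⊤ := by
    obtain ⟨K, hK⟩ := (contDiff_faceToSphere n r i hs).contDiffOn.exists_lipschitzOnWith
      one_ne_zero (convex_closedBall 0 1) (isCompact_closedBall 0 1)
    refine (hK.hausdorffMeasure_image_le n.cast_nonneg).trans_lt ?_
    rw [hausdorffMeasure_eq_volume_pi]
    exact ENNReal.mul_lt_top (ENNReal.rpow_lt_top_of_nonneg n.cast_nonneg ENNReal.coe_ne_top)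
      measure_closedBall_lt_top
  refine (measure_mono (sphere_subset_iUnion_faceToSphere n hr)).trans_lt ?_
  refine (measure_iUnion_le _).trans_lt ?_
  rw [tsum_fintype]
  exact ENNReal.sum_lt_top.2 fun i _ => (measure_union_le _ _).trans_lt
    (ENNReal.add_lt_top.2 ⟨hface i one_ne_zero, hface i (by norm_num)⟩)

lemma hausdorffMeasure_sphere_pos (n : ℕ) {r : ℝ} (hr : 0 < r) :
    0 < μH[(n : ℝ)] (Metric.sphere (0 : E (n + 1)) r) := by
  let π : E (n + 1) → Fin n → ℝ := fun x j => x j.castSucc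
  have hπ : LipschitzWith 1 π := by
    refine LipschitzWith.of_dist_le_mul fun x y => ?_
    rw [NNReal.coe_one, one_mul, dist_pi_le_iff dist_nonneg]
    intro j
    rw [dist_eq_norm, dist_eq_norm]
    exact PiLp.norm_apply_le (x - y) j.castSucc
  have hopen : IsOpen {y : Fin n → ℝ | ∑ j, y j ^ 2 < r ^ 2} :=
    isOpen_lt (by fun_prop) continuous_const
  have hsub : {y : Fin n → ℝ | ∑ j, y j ^ 2 < r ^ 2} ⊆ π '' Metric.sphere 0 r := by
    intro y hy
    refine ⟨WithLp.toLp 2 (Fin.snoc y (√(r ^ 2 - ∑ j, y j ^ 2))), ?_, ?_⟩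
    · rw [mem_sphere_zero_iff_norm, EuclideanSpace.norm_eq, Fin.sum_univ_castSucc]
      simp only [Fin.snoc_castSucc, Fin.snoc_last, Real.norm_eq_abs, sq_abs]
      rw [Real.sq_sqrt (sub_nonneg.2 (le_of_lt hy)), add_sub_cancel, Real.sqrt_sq hr.le]
    · ext j
      simp [π]
  have hvol : 0 < (volume : Measure (Fin n → ℝ)) {y | ∑ j, y j ^ 2 < r ^ 2} :=
    hopen.measure_pos _ ⟨0, by simpa using pow_pos hr 2⟩
  rw [← hausdorffMeasure_eq_volume_pi] at hvol
  calc
    0 < μH[(n : ℝ)] {y : Fin n → ℝ | ∑ j, y j ^ 2 < r ^ 2} := hvol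
    _ ≤ μH[(n : ℝ)] (π '' Metric.sphere 0 r) := measure_mono hsub
    _ ≤ _ := by simpa using hπ.hausdorffMeasure_image_le n.cast_nonneg (Metric.sphere 0 r)

lemma hausdorffMeasure_sphere_ne_zero {d : ℕ} (hd : 1 ≤ d) {r : ℝ} (hr : 0 < r) :
    μH[(d : ℝ) - 1] (Metric.sphere (0 : E d) r) ≠ 0 := by
  obtain ⟨n, rfl⟩ := Nat.exists_eq_add_of_le' hd
  simpa using (hausdorffMeasure_sphere_pos n hr).ne'

lemma hausdorffMeasure_sphere_ne_top {d : ℕ} (hd : 1 ≤ d) {r : ℝ} (hr : 0 < r) :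
    μH[(d : ℝ) - 1] (Metric.sphere (0 : E d) r) ≠ ⊤ := by
  obtain ⟨n, rfl⟩ := Nat.exists_eq_add_of_le' hd
  simpa using (hausdorffMeasure_sphere_lt_top n hr).ne

lemma isProbabilityMeasure_uniformSphere {d : ℕ} (hd : 1 ≤ d) {r : ℝ} (hr : 0 < r) :
    IsProbabilityMeasure (uniformSphere d r) := by
  constructor
  rw [uniformSphere, Measure.smul_apply, Measure.restrict_apply_univ, smul_eq_mul]
  exact ENNReal.inv_mul_cancel (hausdorffMeasure_sphere_ne_zero hd hr)
    (hausdorffMeasure_sphere_ne_top hd hr)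

lemma ae_norm_eq_uniformSphere (d : ℕ) (r : ℝ) : ∀ᵐ x ∂uniformSphere d r, ‖x‖ = r := by
  refine Measure.ae_smul_measure ?_ _
  filter_upwards [ae_restrict_mem Metric.isClosed_sphere.measurableSet] with x hx
  simpa using hx

open scoped Pointwise in
lemma map_smul_uniformSphere {d : ℕ} (hd : 1 ≤ d) {r c : ℝ} (hc : 0 < c) :
    (uniformSphere d r).map (fun x => c • x) = uniformSphere d (c * r) := by
  have hd' : (0 : ℝ) ≤ (d : ℝ) - 1 := sub_nonneg.2 (by exact_mod_cast hd)
  have hsphere : Metric.sphere (0 : E d) (c * r) = c • Metric.sphere (0 : E d) r := by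
    rw [smul_sphere' hc.ne', smul_zero, Real.norm_eq_abs, abs_of_pos hc]
  have hk : ‖c‖₊ ^ ((d : ℝ) - 1) ≠ 0 :=
    (NNReal.rpow_pos (nnnorm_pos.2 hc.ne')).ne'
  ext s hs
  have hpre : Metric.sphere (0 : E d) (c * r) ∩ s =
      c • (Metric.sphere (0 : E d) r ∩ (fun x => c • x) ⁻¹' s) := by
    rw [Set.smul_set_inter₀ hc.ne', ← hsphere, Set.preimage_smul₀ hc.ne', smul_inv_smul₀ hc.ne']
  have hmeas : Measurable (fun x : E d => c • x) := measurable_const_smul c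
  rw [Measure.map_apply hmeas hs, uniformSphere, uniformSphere,
    Measure.smul_apply, Measure.smul_apply, Measure.restrict_apply (hmeas hs),
    Measure.restrict_apply hs, Set.inter_comm s, hpre, hsphere,
    Measure.hausdorffMeasure_smul₀ hd' hc.ne', Measure.hausdorffMeasure_smul₀ hd' hc.ne',
    Set.inter_comm, smul_eq_mul, smul_eq_mul, ENNReal.smul_def, ENNReal.smul_def, smul_eq_mul,
    smul_eq_mul, ENNReal.mul_inv (.inl (by exact_mod_cast hk)) (.inl ENNReal.coe_ne_top),
    mul_mul_mul_comm, ENNReal.inv_mul_cancel (by exact_mod_cast hk) ENNReal.coe_ne_top, one_mul]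

section Couplings

variable {d : ℕ} {r₁ r₂ : ℝ} {γ : Measure (E d × E d)}

lemma IsCoupling.ae_norm_fst_eq (hγ : IsCoupling (uniformSphere d r₁) (uniformSphere d r₂) γ) :
    ∀ᵐ p ∂γ, ‖p.1‖ = r₁ :=
  ae_of_ae_map measurable_fst.aemeasurable (hγ.2.1 ▸ ae_norm_eq_uniformSphere d r₁)

lemma IsCoupling.ae_norm_snd_eq (hγ : IsCoupling (uniformSphere d r₁) (uniformSphere d r₂) γ) :
    ∀ᵐ p ∂γ, ‖p.2‖ = r₂ :=
  ae_of_ae_map measurable_snd.aemeasurable (hγ.2.2 ▸ ae_norm_eq_uniformSphere d r₂)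

lemma IsCoupling.integrable_norm_sub_sq
    (hγ : IsCoupling (uniformSphere d r₁) (uniformSphere d r₂) γ) :
    Integrable (fun p : E d × E d => ‖p.1 - p.2‖ ^ 2) γ := by
  have := hγ.1
  refine Integrable.of_bound (by fun_prop) ((r₁ + r₂) ^ 2) ?_
  filter_upwards [hγ.ae_norm_fst_eq, hγ.ae_norm_snd_eq] with p h₁ h₂
  rw [norm_pow, norm_norm, ← h₁, ← h₂]
  gcongr
  exact norm_sub_le _ _

lemma IsCoupling.ae_sq_le_norm_sub_sq
    (hγ : IsCoupling (uniformSphere d r₁) (uniformSphere d r₂) γ) :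
    ∀ᵐ p ∂γ, (r₂ - r₁) ^ 2 ≤ ‖p.1 - p.2‖ ^ 2 := by
  filter_upwards [hγ.ae_norm_fst_eq, hγ.ae_norm_snd_eq] with p h₁ h₂
  rw [← h₁, ← h₂, sq_le_sq, abs_norm, norm_sub_rev]
  exact abs_norm_sub_norm_le _ _

lemma IsCoupling.sq_le_integral_norm_sub_sq
    (hγ : IsCoupling (uniformSphere d r₁) (uniformSphere d r₂) γ) :
    (r₂ - r₁) ^ 2 ≤ ∫ p, ‖p.1 - p.2‖ ^ 2 ∂γ := by
  have := hγ.1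
  simpa using integral_mono_ae (integrable_const _) hγ.integrable_norm_sub_sq
    hγ.ae_sq_le_norm_sub_sq

lemma IsCoupling.ae_snd_eq_smul_fst (hr₁ : 0 < r₁)
    (hγ : IsCoupling (uniformSphere d r₁) (uniformSphere d r₂) γ)
    (hcost : ∫ p, ‖p.1 - p.2‖ ^ 2 ∂γ = (r₂ - r₁) ^ 2) :
    ∀ᵐ p ∂γ, p.2 = (r₂ / r₁) • p.1 := by
  have := hγ.1
  have heq : (fun _ => (r₂ - r₁) ^ 2) =ᵐ[γ] fun p => ‖p.1 - p.2‖ ^ 2 := by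
    refine (integral_eq_iff_of_ae_le (integrable_const _) hγ.integrable_norm_sub_sq
      hγ.ae_sq_le_norm_sub_sq).1 ?_
    simpa using hcost.symm
  filter_upwards [heq, hγ.ae_norm_fst_eq, hγ.ae_norm_snd_eq] with p h h₁ h₂
  have hinner : ⟪p.1, p.2⟫ = ‖p.1‖ * ‖p.2‖ := by
    rw [norm_sub_sq_real] at h
    rw [h₁, h₂] at h ⊢
    linarith
  rw [inner_eq_norm_mul_iff_real, h₁, h₂] at hinner
  rw [div_eq_inv_mul, mul_smul, hinner, inv_smul_smul₀ hr₁.ne']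

lemma IsCoupling.eq_map_of_integral_eq (hr₁ : 0 < r₁)
    (hγ : IsCoupling (uniformSphere d r₁) (uniformSphere d r₂) γ)
    (hcost : ∫ p, ‖p.1 - p.2‖ ^ 2 ∂γ = (r₂ - r₁) ^ 2) :
    γ = (uniformSphere d r₁).map (fun x => (x, (r₂ / r₁) • x)) := by
  have hgraph : (fun p : E d × E d => (p.1, (r₂ / r₁) • p.1)) =ᵐ[γ] id := by
    filter_upwards [hγ.ae_snd_eq_smul_fst hr₁ hcost] with p hp
    exact Prod.ext rfl hp.symm
  rw [← hγ.2.1, Measure.map_map (by fun_prop) measurable_fst]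
  exact Measure.map_id.symm.trans (Measure.map_congr hgraph.symm)

end Couplings

/-- the optimal quadratic-cost transport between uniform measures on two
concentric spheres moves points radially outwards. -/
theorem stmt_9 {d : ℕ} (hd : 2 ≤ d) {r₁ r₂ : ℝ} (hr₁ : 0 < r₁) (hr₁₂ : r₁ < r₂)
    -- `γ*` is the pushforward of `σ₁` under `x ↦ (x, (r₂/r₁) x)`
    (γstar : Measure (E d × E d))
    (hγstar : γstar = (uniformSphere d r₁).map (fun x => (x, (r₂ / r₁) • x))) :
    -- (a) scaling pushes `σ₁` to `σ₂`
    (uniformSphere d r₁).map (fun x => (r₂ / r₁) • x) = uniformSphere d r₂ ∧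
    -- (b) every coupling has quadratic cost at least `(r₂ - r₁)²`
    (∀ γ : Measure (E d × E d), IsCoupling (uniformSphere d r₁) (uniformSphere d r₂) γ →
      (r₂ - r₁) ^ 2 ≤ ∫ p, ‖p.1 - p.2‖ ^ 2 ∂γ) ∧
    -- (c) `γ*` is a coupling achieving cost `(r₂ - r₁)²` ...
    IsCoupling (uniformSphere d r₁) (uniformSphere d r₂) γstar ∧
    (∫ p, ‖p.1 - p.2‖ ^ 2 ∂γstar) = (r₂ - r₁) ^ 2 ∧
    -- ... and it is the unique minimizer ...
    (∀ γ : Measure (E d × E d), IsCoupling (uniformSphere d r₁) (uniformSphere d r₂) γ →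
      (∫ p, ‖p.1 - p.2‖ ^ 2 ∂γ) = (r₂ - r₁) ^ 2 → γ = γstar) ∧
    -- ... and `γ*`-almost every pair has cosine similarity one
    (∀ᵐ p ∂γstar, ⟪p.1, p.2⟫ / (‖p.1‖ * ‖p.2‖) = 1) := by
  have hr₂ : 0 < r₂ := hr₁.trans hr₁₂
  have hd₁ : 1 ≤ d := one_le_two.trans hd
  have hc : 0 < r₂ / r₁ := div_pos hr₂ hr₁
  have hprob := isProbabilityMeasure_uniformSphere hd₁ hr₁
  have hscale : (uniformSphere d r₁).map (fun x => (r₂ / r₁) • x) = uniformSphere d r₂ := by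
    rw [map_smul_uniformSphere hd₁ hc, div_mul_cancel₀ _ hr₁.ne']
  have hgraph : Measurable (fun x : E d => (x, (r₂ / r₁) • x)) := by fun_prop
  have hcoupling : IsCoupling (uniformSphere d r₁) (uniformSphere d r₂) γstar := by
    subst hγstar
    refine ⟨Measure.isProbabilityMeasure_map hgraph.aemeasurable, ?_, ?_⟩
    · rw [Measure.map_map measurable_fst hgraph]
      exact Measure.map_id
    · rw [Measure.map_map measurable_snd hgraph]
      exact hscale
  have hradial : ∀ᵐ p ∂γstar, p.2 = (r₂ / r₁) • p.1 := by
    rw [hγstar, ae_map_iff hgraph.aemeasurable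
      (measurableSet_eq_fun measurable_snd (by fun_prop))]
    exact ae_of_all _ fun _ => rfl
  have := hcoupling.1
  refine ⟨hscale, fun γ hγ => hγ.sq_le_integral_norm_sub_sq, hcoupling, ?_,
    fun γ hγ hcost => hγstar ▸ hγ.eq_map_of_integral_eq hr₁ hcost, ?_⟩
  · have hcost : (fun p => ‖p.1 - p.2‖ ^ 2) =ᵐ[γstar] fun _ => (r₂ - r₁) ^ 2 := by
      filter_upwards [hradial, hcoupling.ae_norm_fst_eq] with p hp h₁
      have hsub : p.1 - p.2 = (1 - r₂ / r₁) • p.1 := by rw [hp, sub_smul, one_smul]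
      rw [hsub, norm_smul, h₁, mul_pow, Real.norm_eq_abs, sq_abs]
      field_simp
      ring
    rw [integral_congr_ae hcost]
    simp
  · filter_upwards [hradial, hcoupling.ae_norm_fst_eq] with p hp h₁
    rw [hp, real_inner_smul_right, real_inner_self_eq_norm_sq, norm_smul, h₁, Real.norm_eq_abs,
      abs_of_pos hc]
    field_simp

end
end
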